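/- Let X be a special (abstract) rank one group with unipotent subgroups A and B, and let 1 ≠ a₁ ∈ A and 1 ≠ a₂ ∈ A with a₁a₂ ≠ 1. Then there exists a₀ ∈ A ∩ [X,X] such that A^{b(a₁)·b(a₂)} = B^{a₁⁻¹·a₀}. -/

import Mathlib

/-- The conjugate subgroup `S^g = g⁻¹ S g`. -/
def conjSub {X : Type*} [Group X] (S : Subgroup X) (g : X) : Subgroup X :=
  S.map (MulAut.conj g⁻¹).toMonoidHom

/-- `X` is an (abstract) rank one group with unipotent subgroups `A` and `B`:
`A ≠ B`, `X = ⟨A, B⟩`, for each `1 ≠ a ∈ A` there is `1 ≠ b ∈ B` with `A^b = B^a`,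
and vice versa. -/
structure IsRankOneGroup {X : Type*} [Group X] (A B : Subgroup X) : Prop where
  ne : A ≠ B
  gen : A ⊔ B = ⊤
  exB : ∀ a ∈ A, a ≠ 1 → ∃ b ∈ B, b ≠ 1 ∧ conjSub A b = conjSub B a
  exA : ∀ b ∈ B, b ≠ 1 → ∃ a ∈ A, a ≠ 1 ∧ conjSub B a = conjSub A b

/-- `bf` implements `a ↦ b(a)`, the unique `1 ≠ b ∈ B` with `A^b = B^a`, for `1 ≠ a ∈ A`. -/
def IsBFun {X : Type*} [Group X] (A B : Subgroup X) (bf : X → X) : Prop :=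
  ∀ a ∈ A, a ≠ 1 → bf a ∈ B ∧ bf a ≠ 1 ∧ conjSub A (bf a) = conjSub B a

/-- `af` implements `b ↦ a(b)`, the unique `1 ≠ a ∈ A` with `B^a = A^b`, for `1 ≠ b ∈ B`. -/
def IsAFun {X : Type*} [Group X] (A B : Subgroup X) (af : X → X) : Prop :=
  ∀ b ∈ B, b ≠ 1 → af b ∈ A ∧ af b ≠ 1 ∧ conjSub B (af b) = conjSub A b

/-- `X` is special: `b(a⁻¹) = b(a)⁻¹` for all `1 ≠ a ∈ A`. -/
def IsSpecialBFun {X : Type*} [Group X] (A B : Subgroup X) (bf : X → X) : Prop :=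
  IsBFun A B bf ∧ ∀ a ∈ A, a ≠ 1 → bf a⁻¹ = (bf a)⁻¹

/-- The special rank one group condition, phrased without a chosen `b`-function. -/
def IsSpecial {X : Type*} [Group X] (A B : Subgroup X) : Prop :=
  ∃ bf : X → X, IsSpecialBFun A B bf

section RankOne

variable {X : Type*} [Group X]

theorem mem_conjSub {S : Subgroup X} {g x : X} : x ∈ conjSub S g ↔ g * x * g⁻¹ ∈ S := by
  constructor
  · rintro ⟨y, hy, rfl⟩
    simpa [mul_assoc] using hy
  · intro hx
    exact ⟨_, hx, by simp [mul_assoc]⟩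

theorem conjSub_mul (S : Subgroup X) (g k : X) :
    conjSub S (g * k) = conjSub (conjSub S g) k := by
  ext x
  simp [mem_conjSub, mul_assoc]

theorem conjSub_one (S : Subgroup X) : conjSub S 1 = S := by
  ext x
  simp [mem_conjSub]

theorem conjSub_eq_self {S : Subgroup X} {g : X} (hg : g ∈ S) : conjSub S g = S := by
  ext x
  rw [mem_conjSub, S.mul_mem_cancel_right (S.inv_mem hg), S.mul_mem_cancel_left hg]

theorem conjSub_mul_inv_eq {S T : Subgroup X} {g k : X} (hgk : conjSub S g = conjSub T k) :
    conjSub S (g * k⁻¹) = T := by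
  rw [conjSub_mul, hgk, ← conjSub_mul, mul_inv_cancel, conjSub_one]

theorem IsRankOneGroup.symm {A B : Subgroup X} (h : IsRankOneGroup A B) :
    IsRankOneGroup B A :=
  ⟨h.ne.symm, sup_comm A B ▸ h.gen, h.exA, h.exB⟩

/-- `A` acts freely on the conjugates of `B` by elements of `A`. -/
theorem IsRankOneGroup.eq_of_conjSub_eq {A B : Subgroup X} (h : IsRankOneGroup A B)
    {a a' : X} (ha : a ∈ A) (ha' : a' ∈ A) (haa' : conjSub B a = conjSub B a') : a = a' := by
  by_contra hne
  obtain ⟨b, hb, -, hab⟩ :=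
    h.exB (a * a'⁻¹) (A.mul_mem ha (A.inv_mem ha')) (by rwa [Ne, mul_inv_eq_one])
  rw [conjSub_mul_inv_eq haa', ← conjSub_eq_self hb] at hab
  have hAB := conjSub_mul_inv_eq hab
  rw [mul_inv_cancel, conjSub_one] at hAB
  exact h.ne hAB

/-- The identity `a b(a)⁻¹ a = b(a)⁻¹ a b(a)⁻¹`, in the form `(a ^ b(a)) ^ a⁻¹ = b(a)⁻¹`. -/
theorem IsSpecialBFun.conj_eq_inv {A B : Subgroup X} {bf : X → X} (h : IsRankOneGroup A B)
    (hbf : IsSpecialBFun A B bf) {a : X} (ha : a ∈ A) (ha1 : a ≠ 1) :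
    a * ((bf a)⁻¹ * a * bf a) * a⁻¹ = (bf a)⁻¹ := by
  obtain ⟨hb, -, hab⟩ := hbf.1 a ha ha1
  have hinv := (hbf.1 a⁻¹ (A.inv_mem ha) (inv_ne_one.mpr ha1)).2.2
  rw [hbf.2 a ha ha1] at hinv
  refine h.symm.eq_of_conjSub_eq ?_ (B.inv_mem hb) ?_
  · rw [← mem_conjSub, ← hab, mem_conjSub]
    simpa [mul_assoc] using ha
  · have hBA : conjSub A ((bf a)⁻¹ * a) = B := by
      simpa using conjSub_mul_inv_eq hinv
    calc conjSub A (a * ((bf a)⁻¹ * a * bf a) * a⁻¹)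
        = conjSub (conjSub (conjSub (conjSub A a) ((bf a)⁻¹ * a)) (bf a)) a⁻¹ := by
          simp only [conjSub_mul]
      _ = conjSub A (bf a)⁻¹ := by
          rw [conjSub_eq_self ha, hBA, conjSub_eq_self hb, hinv]

theorem IsSpecialBFun.abelianization_of_eq {A B : Subgroup X} {bf : X → X}
    (h : IsRankOneGroup A B) (hbf : IsSpecialBFun A B bf) {a : X} (ha : a ∈ A) (ha1 : a ≠ 1) :
    Abelianization.of (bf a) = (Abelianization.of a)⁻¹ := by
  have key := congrArg Abelianization.of (hbf.conj_eq_inv h ha ha1)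
  simp only [map_mul, map_inv] at key
  rw [mul_inv_cancel_comm, mul_assoc, inv_mul_eq_iff_eq_mul, mul_inv_cancel] at key
  exact (inv_eq_of_mul_eq_one_right key).symm

theorem IsBFun.exists_eq {A B : Subgroup X} {bf : X → X} (h : IsRankOneGroup A B)
    (hbf : IsBFun A B bf) {b : X} (hb : b ∈ B) (hb1 : b ≠ 1) :
    ∃ a ∈ A, a ≠ 1 ∧ bf a = b := by
  obtain ⟨a, ha, ha1, hab⟩ := h.exA b hb hb1
  obtain ⟨hb', -, hab'⟩ := hbf a ha ha1
  exact ⟨a, ha, ha1, h.symm.eq_of_conjSub_eq hb' hb (hab'.trans hab)⟩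

theorem IsBFun.injOn {A B : Subgroup X} {bf : X → X} (h : IsRankOneGroup A B)
    (hbf : IsBFun A B bf) {a a' : X} (ha : a ∈ A) (ha1 : a ≠ 1) (ha' : a' ∈ A) (ha1' : a' ≠ 1)
    (haa' : bf a = bf a') : a = a' :=
  h.eq_of_conjSub_eq ha ha' <| by
    rw [← (hbf a ha ha1).2.2, ← (hbf a' ha' ha1').2.2, haa']

/-- Conjugating `b(a₁)` by `a₂ b(a₂)⁻¹ a₂`, which interchanges `A` and `B`, gives an element
of `A` whose class modulo `[X, X]` is that of `a₁ a₂`. -/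
theorem IsSpecialBFun.abelianization_of_bf {A B : Subgroup X} {bf : X → X}
    (h : IsRankOneGroup A B) (hbf : IsSpecialBFun A B bf) {a₁ a₂ : X} (ha₁ : a₁ ∈ A)
    (ha₁1 : a₁ ≠ 1) (ha₂ : a₂ ∈ A) (ha₂1 : a₂ ≠ 1) (h12 : a₁ * a₂ ≠ 1) :
    Abelianization.of (bf a₁) = Abelianization.of (a₁ * a₂) := by
  obtain ⟨hb₁, -, hab₁⟩ := hbf.1 a₁ ha₁ ha₁1
  obtain ⟨hb₂, -, hab₂⟩ := hbf.1 a₂ ha₂ ha₂1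
  have ha₁₂ := A.mul_mem ha₁ ha₂
  obtain ⟨hb₁₂, -, hab₁₂⟩ := hbf.1 _ ha₁₂ h12
  have hinv := (hbf.1 a₂⁻¹ (A.inv_mem ha₂) (inv_ne_one.mpr ha₂1)).2.2
  rw [hbf.2 a₂ ha₂ ha₂1] at hinv
  have hne : bf (a₁ * a₂) * (bf a₂)⁻¹ ≠ 1 := fun heq =>
    ha₁1 (mul_eq_right.mp (hbf.1.injOn h ha₁₂ h12 ha₂ ha₂1 (mul_inv_eq_one.mp heq)))
  obtain ⟨d, hd, hd1, hbd⟩ := hbf.1.exists_eq h (B.mul_mem hb₁₂ (B.inv_mem hb₂)) hne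
  obtain ⟨n, hn⟩ : ∃ n, n = a₂ * (bf a₂)⁻¹ * a₂ := ⟨_, rfl⟩
  have hBn : conjSub B n = A := by
    rw [hn, conjSub_mul, conjSub_mul_inv_eq hab₂.symm, conjSub_eq_self ha₂]
  have hAn : conjSub A n = B := by
    have := conjSub_mul_inv_eq hinv
    rw [inv_inv] at this
    rw [hn, mul_assoc, conjSub_mul, conjSub_eq_self ha₂, this]
  have hBn' : conjSub B n⁻¹ = A := by
    rw [← hAn, ← conjSub_mul, mul_inv_cancel, conjSub_one]
  have hmem : n⁻¹ * bf a₁ * n ∈ A := by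
    rw [← hBn, mem_conjSub]
    simpa [mul_assoc] using hb₁
  have heq : n⁻¹ * bf a₁ * n = d * a₂ := by
    refine h.eq_of_conjSub_eq hmem (A.mul_mem hd ha₂) ?_
    calc conjSub B (n⁻¹ * bf a₁ * n)
        = conjSub B (a₁ * n) := by
          rw [conjSub_mul, conjSub_mul, hBn', hab₁, ← conjSub_mul]
      _ = conjSub B (a₁ * a₂ * (bf a₂)⁻¹ * a₂) := by simp only [hn, mul_assoc]
      _ = conjSub B (d * a₂) := by
          rw [conjSub_mul _ _ a₂, conjSub_mul _ (a₁ * a₂), ← hab₁₂,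
            ← conjSub_mul _ _ (bf a₂)⁻¹, ← hbd, (hbf.1 d hd hd1).2.2, ← conjSub_mul]
  have hd_class : Abelianization.of d = Abelianization.of a₁ := by
    have := congrArg Abelianization.of hbd
    rw [map_mul, map_inv, hbf.abelianization_of_eq h hd hd1,
      hbf.abelianization_of_eq h ha₁₂ h12, hbf.abelianization_of_eq h ha₂ ha₂1, inv_inv,
      map_mul, mul_inv, inv_mul_cancel_right] at this
    exact inv_injective this
  have := congrArg Abelianization.of heq
  rwa [map_mul, map_mul, map_inv, inv_mul_cancel_comm, map_mul, hd_class, ← map_mul] at this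

end RankOne

/-- In a special rank one group, for `1 ≠ a₁, a₂ ∈ A` with `a₁a₂ ≠ 1`, there is
`a₀ ∈ A ∩ [X,X]` with `A^{b(a₁)·b(a₂)} = B^{a₁⁻¹·a₀}`. -/
theorem specialRankOne_exists_a0 {X : Type*} [Group X] (A B : Subgroup X)
    (h : IsRankOneGroup A B) (bf : X → X) (hbf : IsSpecialBFun A B bf)
    (a₁ a₂ : X) (ha₁ : a₁ ∈ A) (ha₁1 : a₁ ≠ 1) (ha₂ : a₂ ∈ A) (ha₂1 : a₂ ≠ 1)
    (h12 : a₁ * a₂ ≠ 1) :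
    ∃ a₀ ∈ A ⊓ commutator X,
      conjSub A (bf a₁ * bf a₂) = conjSub B (a₁⁻¹ * a₀) := by
  obtain ⟨hb₁, -, -⟩ := hbf.1 a₁ ha₁ ha₁1
  obtain ⟨hb₂, -, -⟩ := hbf.1 a₂ ha₂ ha₂1
  have hne : bf a₁ * bf a₂ ≠ 1 := by
    intro heq
    rw [mul_eq_one_iff_eq_inv, ← hbf.2 a₂ ha₂ ha₂1] at heq
    exact h12 (mul_eq_one_iff_eq_inv.mpr
      (hbf.1.injOn h ha₁ ha₁1 (A.inv_mem ha₂) (inv_ne_one.mpr ha₂1) heq))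
  obtain ⟨c, hc, hc1, hbc⟩ := hbf.1.exists_eq h (B.mul_mem hb₁ hb₂) hne
  refine ⟨a₁ * c, Subgroup.mem_inf.mpr ⟨A.mul_mem ha₁ hc, ?_⟩, ?_⟩
  · have h₁ := hbf.abelianization_of_bf h ha₁ ha₁1 ha₂ ha₂1 h12
    have h₂ := congrArg Abelianization.of hbc
    rw [map_mul, h₁, hbf.abelianization_of_eq h hc hc1, hbf.abelianization_of_eq h ha₂ ha₂1,
      map_mul, mul_inv_cancel_right] at h₂
    rw [← Abelianization.ker_of, MonoidHom.mem_ker, map_mul, ← h₂,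
      inv_mul_cancel]
  · rw [inv_mul_cancel_left, ← hbc, (hbf.1 c hc hc1).2.2]
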